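/- arXiv:math/0510338 — 8 statements merged into one kernel-verified Lean document; each statement's English description precedes it below -/
import Mathlib

section
/- Let a : ℕ → ℕ → ℝ be skew-symmetric (a k i = −(a i k) for all k,i) with |a k i| ≤ 1 for all k,i. Then the map V defined by (V x)_k = x_k·(1 + Σ_i a k i · x_i) maps S into S: for every x ∈ S, (V x)_k ≥ 0 for every k, the family ((V x)_k) is summable, and Σ_k (V x)_k = 1. -/
/-- The infinite-dimensional simplex `S ⊂ ℓ¹(ℕ)`. -/
def simplexS : Set (ℕ → ℝ) :=
  {x | (∀ i, 0 ≤ x i) ∧ Summable x ∧ ∑' i, x i = 1}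

/-- The Volterra operator associated with a matrix `a`:
`(V x)_k = x_k (1 + Σ_i a k i · x_i)`. -/
noncomputable def volterra (a : ℕ → ℕ → ℝ) (x : ℕ → ℝ) : ℕ → ℝ :=
  fun k => x k * (1 + ∑' i, a k i * x i)

theorem abs_tsum_mul_le_of_abs_le_one {b x : ℕ → ℝ} (hb : ∀ i, |b i| ≤ 1)
    (hx0 : ∀ i, 0 ≤ x i) (hx : Summable x) : |∑' i, b i * x i| ≤ ∑' i, x i := by
  rw [← Real.norm_eq_abs]
  refine tsum_of_norm_bounded hx.hasSum fun i => ?_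
  rw [Real.norm_eq_abs, abs_mul, abs_of_nonneg (hx0 i)]
  exact mul_le_of_le_one_left (hx0 i) (hb i)

theorem summable_bilinear_of_abs_le_one {a : ℕ → ℕ → ℝ} {x : ℕ → ℝ}
    (ha : ∀ k i, |a k i| ≤ 1) (hx0 : ∀ i, 0 ≤ x i) (hx : Summable x) :
    Summable fun p : ℕ × ℕ => x p.1 * (a p.1 p.2 * x p.2) := by
  refine Summable.of_norm_bounded (hx.mul_of_nonneg hx hx0 hx0) fun p => ?_
  rw [Real.norm_eq_abs, abs_mul, abs_mul, abs_of_nonneg (hx0 p.1), abs_of_nonneg (hx0 p.2)]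
  exact mul_le_mul_of_nonneg_left (mul_le_of_le_one_left (hx0 _) (ha _ _)) (hx0 _)

theorem tsum_bilinear_eq_zero_of_skew {a : ℕ → ℕ → ℝ} (hskew : ∀ k i, a k i = -(a i k))
    (x : ℕ → ℝ) : ∑' p : ℕ × ℕ, x p.1 * (a p.1 p.2 * x p.2) = 0 := by
  have h : ∑' p : ℕ × ℕ, x p.1 * (a p.1 p.2 * x p.2)
      = -∑' p : ℕ × ℕ, x p.1 * (a p.1 p.2 * x p.2) := by
    conv_lhs => rw [← (Equiv.prodComm ℕ ℕ).tsum_eq]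
    rw [← tsum_neg]
    refine tsum_congr fun p => ?_
    simp only [Equiv.prodComm_apply, Prod.fst_swap, Prod.snd_swap]
    rw [hskew p.2 p.1]
    ring
  linarith

/-- a Volterra operator (given by a skew-symmetric matrix with entries
bounded by 1) maps `S` into `S`. -/
theorem stmt3 (a : ℕ → ℕ → ℝ)
    (hskew : ∀ k i, a k i = -(a i k))
    (hbound : ∀ k i, |a k i| ≤ 1) :
    ∀ x ∈ simplexS,
      (∀ k, 0 ≤ volterra a x k) ∧ Summable (volterra a x) ∧
        ∑' k, volterra a x k = 1 := by
  rintro x ⟨hx0, hx, hx1⟩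
  have hsum := summable_bilinear_of_abs_le_one hbound hx0 hx
  have hV : volterra a x = fun k => x k + ∑' i, x k * (a k i * x i) := by
    funext k
    rw [volterra, tsum_mul_left]
    ring
  have hHas : HasSum (volterra a x) 1 := by
    have h := hx.hasSum.add hsum.prod.hasSum
    rw [← hsum.tsum_prod, tsum_bilinear_eq_zero_of_skew hskew, hx1, add_zero] at h
    rw [hV]
    exact h
  refine ⟨fun k => mul_nonneg (hx0 k) ?_, hHas.summable, hHas.tsum_eq⟩
  have h := abs_tsum_mul_le_of_abs_le_one (hbound k) hx0 hx
  rw [hx1] at h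
  linarith [neg_le_of_abs_le h]
end

section
/- Every Volterra operator V : S → S is a bijection of S onto itself. -/
section Skew

variable {ι : Type*} {a : ι → ι → ℝ} {x : ι → ℝ}

lemma summable_bounded_mul {b : ι → ℝ} (hb : ∀ i, |b i| ≤ 1) (hx : Summable x) :
    Summable fun i => b i * x i := by
  refine Summable.of_norm_bounded hx.norm fun i => ?_
  rw [norm_mul]
  exact mul_le_of_le_one_left (norm_nonneg _) (hb i)

lemma hasSum_skew_eq_zero (hskew : ∀ k i, a k i = -(a i k)) (hbound : ∀ k i, |a k i| ≤ 1)
    (hx : Summable x) : HasSum (fun k => x k * ∑' i, a k i * x i) 0 := by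
  have hs : Summable (Function.uncurry fun k i => x k * (a k i * x i)) := by
    have h := hx.norm.mul_of_nonneg hx.norm (fun i => norm_nonneg _) (fun i => norm_nonneg _)
    refine Summable.of_norm_bounded h fun p => ?_
    simp only [Function.uncurry, norm_mul]
    exact mul_le_mul_of_nonneg_left
      (mul_le_of_le_one_left (norm_nonneg _) (hbound _ _)) (norm_nonneg _)
  have hin : Summable fun k => ∑' i, x k * (a k i * x i) := hs.prod
  have h0 : ∑' k, ∑' i, x k * (a k i * x i) = 0 := by
    have hc := hs.tsum_comm
    have hn : ∑' k, ∑' i, x i * (a i k * x k) = -∑' k, ∑' i, x k * (a k i * x i) := by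
      rw [← tsum_neg]
      refine tsum_congr fun k => ?_
      rw [← tsum_neg]
      refine tsum_congr fun i => ?_
      rw [hskew i k]
      ring
    linarith
  have := hin.hasSum
  rw [h0] at this
  simpa only [tsum_mul_left] using this

lemma le_one_add_tsum_mul (hskew : ∀ k i, a k i = -(a i k)) (hbound : ∀ k i, |a k i| ≤ 1)
    (h0 : ∀ i, 0 ≤ x i) (hx : HasSum x 1) (k : ι) : x k ≤ 1 + ∑' i, a k i * x i := by
  have h := hx.add (summable_bounded_mul (hbound k) hx.summable).hasSum
  have hk := le_hasSum h k fun j _ => by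
    nlinarith [h0 j, (abs_le.mp (hbound k j)).1]
  have : a k k = 0 := by linarith [hskew k k]
  simpa [this] using hk

end Skew

/-- On a finite simplex, a maximizer of `∏ (V x)_k ^ y_k` is a preimage of `y`. -/
lemma exists_volterra_preimage_of_fintype {ι : Type*} [Fintype ι] {a : ι → ι → ℝ}
    (hskew : ∀ k i, a k i = -(a i k)) (hbound : ∀ k i, |a k i| ≤ 1) {y : ι → ℝ}
    (hy : y ∈ stdSimplex ℝ ι) :
    ∃ x ∈ stdSimplex ℝ ι, ∀ k, x k * (1 + ∑ i, a k i * x i) = y k := by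
  have hle : ∀ x ∈ stdSimplex ℝ ι, ∀ k, x k ≤ 1 + ∑ i, a k i * x i := fun x hx k => by
    have h := le_one_add_tsum_mul hskew hbound hx.1 (hx.2 ▸ hasSum_fintype x) k
    rwa [tsum_fintype] at h
  have hzero : ∀ x : ι → ℝ, ∑ k, x k * ∑ i, a k i * x i = 0 := fun x => by
    have h := (hasSum_skew_eq_zero hskew hbound (hasSum_fintype x).summable).tsum_eq
    simpa only [tsum_fintype] using h
  have hcont : Continuous fun x : ι → ℝ => ∏ k, (x k * (1 + ∑ i, a k i * x i)) ^ y k := by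
    refine continuous_finsetProd _ fun k _ => ?_
    exact Continuous.rpow_const (by fun_prop) fun _ => Or.inr (hy.1 k)
  obtain ⟨x, hx, hmax⟩ := (isCompact_stdSimplex ℝ ι).exists_isMaxOn ⟨y, hy⟩ hcont.continuousOn
  have hz0 : ∀ k, 0 ≤ x k * (1 + ∑ i, a k i * x i) := fun k =>
    mul_nonneg (hx.1 k) ((hx.1 k).trans (hle x hx k))
  have hPy : 0 < ∏ k, (y k * (1 + ∑ i, a k i * y i)) ^ y k := by
    refine Finset.prod_pos fun k _ => ?_
    rcases (hy.1 k).eq_or_lt with h | h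
    · simp [← h]
    · exact Real.rpow_pos_of_pos (mul_pos h (h.trans_le (hle y hy k))) _
  have hPx : 0 < ∏ k, (x k * (1 + ∑ i, a k i * x i)) ^ y k := hPy.trans_le (hmax hy)
  have hxpos : ∀ k, 0 < y k → 0 < x k := fun k hk => by
    refine (hx.1 k).lt_of_ne fun h => hPx.ne' ?_
    refine Finset.prod_eq_zero (Finset.mem_univ k) ?_
    rw [← h, zero_mul, Real.zero_rpow hk.ne']
  have hupos : ∀ k, 0 < y k → 0 < 1 + ∑ i, a k i * x i := fun k hk =>
    (hxpos k hk).trans_le (hle x hx k)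
  set u : ι → ℝ := fun k => 1 + ∑ i, a k i * x i with hu
  set w : ι → ℝ := fun k => y k / u k with hw
  have hw0 : ∀ k, 0 ≤ w k := fun k => div_nonneg (hy.1 k) ((hx.1 k).trans (hle x hx k))
  have hwu : ∀ k, w k * u k = y k := fun k => by
    rcases (hy.1 k).eq_or_lt with h | h
    · simp [hw, ← h]
    · exact div_mul_cancel₀ _ (hupos k h).ne'
  set W : ℝ := ∑ k, w k with hW
  have hWpos : 0 < W := by
    refine (Finset.sum_nonneg fun k _ => hw0 k).lt_of_ne fun h => ?_
    have h1 := (Finset.sum_eq_zero_iff_of_nonneg fun k _ => hw0 k).1 h.symm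
    have h2 : ∑ k, y k = 0 := Finset.sum_eq_zero fun k hk => by rw [← hwu k, h1 k hk, zero_mul]
    linarith [hy.2]
  set v : ι → ℝ := fun k => w k / W with hv
  have hvS : v ∈ stdSimplex ℝ ι :=
    ⟨fun k => div_nonneg (hw0 k) hWpos.le, by
      rw [← Finset.sum_div]; exact div_self hWpos.ne'⟩
  set d : ι → ℝ := fun k => ∑ i, a k i * (v i - x i) with hd
  set g : ℝ → ℝ := fun t =>
    ∑ k, y k * (Real.log (x k + t * (v k - x k)) + Real.log (u k + t * d k)) with hg
  set D : ℝ := ∑ k, y k * ((v k - x k) / x k + d k / u k) with hD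
  have hder : HasDerivAt g D 0 := by
    refine HasDerivAt.fun_sum fun k _ => ?_
    rcases (hy.1 k).eq_or_lt with h | h
    · simpa [← h] using hasDerivAt_const (0 : ℝ) (0 : ℝ)
    · have e1 : HasDerivAt (fun t : ℝ => x k + t * (v k - x k)) (v k - x k) 0 := by
        simpa using ((hasDerivAt_id (0 : ℝ)).mul_const (v k - x k)).const_add (x k)
      have e2 : HasDerivAt (fun t : ℝ => u k + t * d k) (d k) 0 := by
        simpa using ((hasDerivAt_id (0 : ℝ)).mul_const (d k)).const_add (u k)
      have f1 := e1.log (by simpa using (hxpos k h).ne')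
      have f2 := e2.log (by simpa using (hupos k h).ne')
      simpa using (f1.add f2).const_mul (y k)
  have hgle : ∀ t ∈ Set.Ioo (0 : ℝ) 1, g t ≤ g 0 := fun t ht => by
    have hmem : (fun k => x k + t * (v k - x k)) ∈ stdSimplex ℝ ι := by
      have := (convex_stdSimplex ℝ ι) hx hvS (sub_nonneg.2 ht.2.le) ht.1.le (by ring)
      convert this using 1
      ext k
      simp only [Pi.add_apply, Pi.smul_apply, smul_eq_mul]
      ring
    have hut : ∀ k, 1 + ∑ i, a k i * (x i + t * (v i - x i)) = u k + t * d k := fun k => by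
      simp only [hu, hd, mul_add, Finset.sum_add_distrib, Finset.mul_sum]
      rw [add_assoc]
      congr 2
      exact Finset.sum_congr rfl fun i _ => by ring
    have hm : ∏ k, ((x k + t * (v k - x k)) * (u k + t * d k)) ^ y k ≤ ∏ k, (x k * u k) ^ y k := by
      have h := hmax hmem
      simp only [Set.mem_ofPred_eq, hut] at h
      exact h
    have hxt : ∀ k, 0 < y k → 0 < x k + t * (v k - x k) := fun k hk => by
      have h1 := mul_pos (sub_pos.2 ht.2) (hxpos k hk)
      have h2 := mul_nonneg ht.1.le (hvS.1 k)
      linarith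
    have hutp : ∀ k, 0 < y k → 0 < u k + t * d k := fun k hk => by
      have h := hle _ hmem k
      rw [hut] at h
      exact (hxt k hk).trans_le h
    have key : ∀ p q : ι → ℝ, (∀ k, 0 < y k → 0 < p k) → (∀ k, 0 < y k → 0 < q k) →
        ∏ k, (p k * q k) ^ y k = Real.exp (∑ k, y k * (Real.log (p k) + Real.log (q k))) := by
      intro p q hp hq
      rw [Real.exp_sum]
      refine Finset.prod_congr rfl fun k _ => ?_
      rcases (hy.1 k).eq_or_lt with h | h
      · simp [← h]
      · rw [Real.rpow_def_of_pos (mul_pos (hp k h) (hq k h)),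
          Real.log_mul (hp k h).ne' (hq k h).ne', mul_comm]
    rw [key _ _ hxt hutp, key _ _ hxpos hupos, Real.exp_le_exp] at hm
    simpa [hg] using hm
  have hDle : D ≤ 0 := by
    have h1 := hder.hasDerivWithinAt (s := Set.Ioi 0)
    rw [hasDerivWithinAt_iff_tendsto_slope' (by simp)] at h1
    refine le_of_tendsto h1 ?_
    filter_upwards [Ioo_mem_nhdsGT (zero_lt_one (α := ℝ))] with t ht
    rw [slope_def_field, sub_zero]
    exact div_nonpos_of_nonpos_of_nonneg (sub_nonpos.2 (hgle t ht)) ht.1.le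
  have hzsum : ∑ k, x k * u k = 1 := by
    simp only [hu, mul_add, mul_one, Finset.sum_add_distrib, hzero, hx.2, add_zero]
  have hDeq : D = (∑ k, y k ^ 2 / (x k * u k)) / W - 2 + W := by
    have e1 : ∀ k, y k * ((v k - x k) / x k + d k / u k)
        = y k ^ 2 / (x k * u k) / W - y k + w k * d k := fun k => by
      rcases (hy.1 k).eq_or_lt with h | h
      · simp [← h, hw]
      · have := (hxpos k h).ne'
        have := (hupos k h).ne'
        simp only [hv, hw]
        field_simp
    have e2 : ∑ k, w k * d k = W - 1 := by
      have e3 : ∀ k, w k * d k = (w k * ∑ i, a k i * w i) / W - y k + w k := fun k => by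
        have e4 : d k = (∑ i, a k i * w i) / W - (u k - 1) := by
          simp only [hd, hu, hv, mul_sub, Finset.sum_sub_distrib, Finset.sum_div]
          simp only [mul_div_assoc]
          ring
        rw [e4, ← hwu k]
        ring
      simp only [e3, Finset.sum_add_distrib, Finset.sum_sub_distrib, ← Finset.sum_div, hzero,
        hy.2, zero_div]
      ring
    simp only [hD, e1, Finset.sum_add_distrib, Finset.sum_sub_distrib, ← Finset.sum_div, e2, hy.2]
    ring
  have hQ : ∑ k, y k ^ 2 / (x k * u k) ≤ 1 := by
    have h : (∑ k, y k ^ 2 / (x k * u k)) / W ≤ 2 - W := by linarith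
    rw [div_le_iff₀ hWpos] at h
    nlinarith [sq_nonneg (W - 1)]
  have hsq : ∀ k, y k ^ 2 / (x k * u k) - 2 * y k + x k * u k
      = (y k - x k * u k) ^ 2 / (x k * u k) := fun k => by
    by_cases h0 : x k * u k = 0
    · rcases (hy.1 k).eq_or_lt with h | h
      · simp [h0, ← h]
      · exact absurd h0 (mul_pos (hxpos k h) (hupos k h)).ne'
    · generalize x k * u k = z at h0 ⊢
      field_simp
      ring
  have hsum : ∑ k, (y k - x k * u k) ^ 2 / (x k * u k) ≤ 0 := by
    simp only [← hsq, Finset.sum_add_distrib, Finset.sum_sub_distrib, ← Finset.mul_sum, hzsum, hy.2]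
    linarith
  have hnn : ∀ k ∈ Finset.univ, 0 ≤ (y k - x k * u k) ^ 2 / (x k * u k) := fun k _ =>
    div_nonneg (sq_nonneg _) (hz0 k)
  have hall := (Finset.sum_eq_zero_iff_of_nonneg hnn).1 (hsum.antisymm (Finset.sum_nonneg hnn))
  refine ⟨x, hx, fun k => ?_⟩
  rcases div_eq_zero_iff.1 (hall k (Finset.mem_univ k)) with h | h
  · linarith [pow_eq_zero_iff two_ne_zero |>.1 h]
  · rcases (hy.1 k).eq_or_lt with hk | hk
    · rw [← hk]
      exact h
    · exact absurd h (mul_pos (hxpos k hk) (hupos k hk)).ne'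

lemma mem_simplexS_iff {x : ℕ → ℝ} : x ∈ simplexS ↔ (∀ i, 0 ≤ x i) ∧ HasSum x 1 :=
  ⟨fun h => ⟨h.1, h.2.2 ▸ h.2.1.hasSum⟩, fun h => ⟨h.1, h.2.summable, h.2.tsum_eq⟩⟩

section Volterra

variable {a : ℕ → ℕ → ℝ}

lemma mapsTo_volterra (hskew : ∀ k i, a k i = -(a i k)) (hbound : ∀ k i, |a k i| ≤ 1) :
    Set.MapsTo (volterra a) simplexS simplexS := by
  intro x hx
  rw [mem_simplexS_iff] at hx ⊢
  refine ⟨fun k => mul_nonneg (hx.1 k)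
    ((hx.1 k).trans (le_one_add_tsum_mul hskew hbound hx.1 hx.2 k)), ?_⟩
  have h := hx.2.add (hasSum_skew_eq_zero hskew hbound hx.2.summable)
  rw [add_zero] at h
  exact h.congr_fun fun k => by simp only [volterra]; ring

lemma injOn_volterra (hskew : ∀ k i, a k i = -(a i k)) (hbound : ∀ k i, |a k i| ≤ 1) :
    Set.InjOn (volterra a) simplexS := by
  intro x hx y hy hxy
  rw [mem_simplexS_iff] at hx hy
  have lt_of_lt : ∀ p q r s : ℝ, 0 ≤ p → 0 ≤ q → p ≤ r → q ≤ s → p * r = q * s → q < p → r < s := by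
    intro p q r s hp hq hr hs h hlt
    by_contra! hc
    nlinarith [mul_pos (sub_pos.2 hlt) (hq.trans_lt hlt |>.trans_le hr),
      mul_nonneg hq (sub_nonneg.2 hc)]
  have hlx := le_one_add_tsum_mul hskew hbound hx.1 hx.2
  have hly := le_one_add_tsum_mul hskew hbound hy.1 hy.2
  have hk : ∀ k, x k * (1 + ∑' i, a k i * x i) = y k * (1 + ∑' i, a k i * y i) := congrFun hxy
  have hs := hasSum_skew_eq_zero hskew hbound (hx.2.sub hy.2).summable
  have hsub : ∀ k, ∑' i, a k i * (x i - y i) = ∑' i, a k i * x i - ∑' i, a k i * y i := fun k => by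
    rw [← (summable_bounded_mul (hbound k) hx.2.summable).tsum_sub
      (summable_bounded_mul (hbound k) hy.2.summable)]
    exact tsum_congr fun i => mul_sub _ _ _
  simp only [hsub] at hs
  have hneg : ∀ k, x k ≠ y k →
      (x k - y k) * (∑' i, a k i * x i - ∑' i, a k i * y i) < 0 := fun k hne => by
    rcases hne.lt_or_gt with h | h
    · have := lt_of_lt _ _ _ _ (hy.1 k) (hx.1 k) (hly k) (hlx k) (hk k).symm h
      exact mul_neg_of_neg_of_pos (by linarith) (by linarith)
    · have := lt_of_lt _ _ _ _ (hx.1 k) (hy.1 k) (hlx k) (hly k) (hk k) h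
      exact mul_neg_of_pos_of_neg (by linarith) (by linarith)
  have hz := (hasSum_zero_iff_of_nonneg (f := fun k =>
      -((x k - y k) * (∑' i, a k i * x i - ∑' i, a k i * y i))) fun k => by
    by_cases h : x k = y k
    · simp [h]
    · exact (neg_pos.2 (hneg k h)).le).1 (by simpa using hs.neg)
  ext k
  by_contra h
  exact (hneg k h).ne (neg_eq_zero.1 (congrFun hz k))

lemma exists_volterra_preimage_of_finite_support (hskew : ∀ k i, a k i = -(a i k))
    (hbound : ∀ k i, |a k i| ≤ 1) {y : ℕ → ℝ} (hy : y ∈ simplexS) {n : ℕ}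
    (hn : ∀ i, n ≤ i → y i = 0) : ∃ x ∈ simplexS, volterra a x = y := by
  rw [mem_simplexS_iff] at hy
  have hyn : ∑ i : Fin n, y i = 1 := by
    rw [Fin.sum_univ_eq_sum_range y n]
    exact (hasSum_sum_of_ne_finset_zero fun i hi => hn i (by simpa using hi)).unique hy.2
  obtain ⟨x, hx, hxy⟩ := exists_volterra_preimage_of_fintype (a := fun k i : Fin n => a k i)
    (fun _ _ => hskew _ _) (fun _ _ => hbound _ _) (y := fun i : Fin n => y i)
    ⟨fun i => hy.1 i, hyn⟩
  set X : ℕ → ℝ := fun i => if h : i < n then x ⟨i, h⟩ else 0 with hX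
  have hXn : ∀ i, n ≤ i → X i = 0 := fun i hi => dif_neg hi.not_gt
  have hXf : ∀ i : Fin n, X i = x i := fun i => dif_pos i.2
  refine ⟨X, mem_simplexS_iff.2 ⟨fun i => ?_, ?_⟩, ?_⟩
  · simp only [hX]
    split_ifs with h
    exacts [hx.1 _, le_rfl]
  · have h : HasSum X (∑ i ∈ Finset.range n, X i) :=
      hasSum_sum_of_ne_finset_zero fun i hi => hXn i (by simpa using hi)
    rw [← Fin.sum_univ_eq_sum_range X n] at h
    simpa only [hXf, hx.2] using h
  · ext k
    rcases lt_or_ge k n with hk | hk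
    · have h : ∑' i, a k i * X i = ∑ i : Fin n, a k i * x i := by
        rw [tsum_eq_sum (s := Finset.range n) fun i hi => by
          rw [hXn i (by simpa using hi), mul_zero],
          ← Fin.sum_univ_eq_sum_range (fun i => a k i * X i) n]
        simp only [hXf]
      have h2 := hxy ⟨k, hk⟩
      simp only [volterra, h]
      rw [← h2, ← hXf ⟨k, hk⟩]
    · simp [volterra, hXn k hk, hn k hk]

lemma sum_range_volterra_le (hskew : ∀ k i, a k i = -(a i k)) (hbound : ∀ k i, |a k i| ≤ 1)
    {x : ℕ → ℝ} (hx : x ∈ simplexS) (N : ℕ) :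
    (1 - ∑ i ∈ Finset.range N, x i) ^ 2 ≤ 1 - ∑ k ∈ Finset.range N, volterra a x k := by
  rw [mem_simplexS_iff] at hx
  have hsk : ∑ k ∈ Finset.range N, x k * ∑ i ∈ Finset.range N, a k i * x i = 0 := by
    have h := (hasSum_skew_eq_zero (a := fun k i : Fin N => a k i) (fun _ _ => hskew _ _)
      (fun _ _ => hbound _ _) (hasSum_fintype fun i : Fin N => x i).summable).tsum_eq
    simp only [tsum_fintype] at h
    rw [← h, Finset.sum_range]
    simp only [Finset.sum_range]
  have htail : ∀ k, ∑' i, a k i * x i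
      ≤ ∑ i ∈ Finset.range N, a k i * x i + (1 - ∑ i ∈ Finset.range N, x i) := fun k => by
    have h := (hx.2.sub (summable_bounded_mul (hbound k) hx.2.summable).hasSum)
    have := sum_le_hasSum (Finset.range N) (fun i _ => by
      nlinarith [hx.1 i, (abs_le.mp (hbound k i)).2]) h
    rw [Finset.sum_sub_distrib] at this
    linarith
  have hmul : ∑ k ∈ Finset.range N, volterra a x k ≤ ∑ k ∈ Finset.range N,
      (x k * (2 - ∑ i ∈ Finset.range N, x i) + x k * ∑ i ∈ Finset.range N, a k i * x i) :=
    Finset.sum_le_sum fun k _ => by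
      rw [← mul_add]
      exact mul_le_mul_of_nonneg_left (by linarith [htail k]) (hx.1 k)
  rw [Finset.sum_add_distrib, hsk, ← Finset.sum_mul] at hmul
  linarith

/-- Sequences whose tails are controlled by the tails of `y`. -/
def tightSet (y : ℕ → ℝ) : Set (ℕ → ℝ) :=
  {x | (∀ i, 0 ≤ x i) ∧ ∀ N, ∑ i ∈ Finset.range N, x i ≤ 1 ∧
    (1 - ∑ i ∈ Finset.range N, x i) ^ 2 ≤ 1 - ∑ i ∈ Finset.range N, y i}

lemma isCompact_tightSet (y : ℕ → ℝ) : IsCompact (tightSet y) := by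
  refine (isCompact_univ_pi fun _ : ℕ => isCompact_Icc (a := (0 : ℝ)) (b := 1)).of_isClosed_subset
    ?_ fun x hx i _ => ⟨hx.1 i, ?_⟩
  · simp only [tightSet, Set.ofPred_and, Set.ofPred_forall]
    refine (isClosed_iInter fun i => isClosed_le (by fun_prop) (by fun_prop)).inter
      (isClosed_iInter fun N => (isClosed_le (by fun_prop) (by fun_prop)).inter
        (isClosed_le (by fun_prop) (by fun_prop)))
  · exact (Finset.single_le_sum (fun j _ => hx.1 j) (Finset.self_mem_range_succ i)).trans
      (hx.2 (i + 1)).1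

lemma tendsto_sqrt_tail {y : ℕ → ℝ} (hy : HasSum y 1) :
    Filter.Tendsto (fun N => √(1 - ∑ i ∈ Finset.range N, y i)) Filter.atTop (nhds 0) := by
  have h := (tendsto_const_nhds (x := (1 : ℝ))).sub hy.tendsto_sum_nat
  simpa using h.sqrt

lemma one_sub_sum_le_sqrt {x y : ℕ → ℝ} (hx : x ∈ tightSet y) (N : ℕ) :
    1 - ∑ i ∈ Finset.range N, x i ≤ √(1 - ∑ i ∈ Finset.range N, y i) :=
  Real.le_sqrt_of_sq_le (hx.2 N).2

lemma tightSet_subset_simplexS {y : ℕ → ℝ} (hy : HasSum y 1) : tightSet y ⊆ simplexS := by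
  intro x hx
  refine mem_simplexS_iff.2 ⟨hx.1, (hasSum_iff_tendsto_nat_of_nonneg hx.1 1).2 ?_⟩
  have h := (tendsto_const_nhds (x := (1 : ℝ))).sub (tendsto_sqrt_tail hy)
  rw [sub_zero] at h
  exact tendsto_of_tendsto_of_tendsto_of_le_of_le h tendsto_const_nhds
    (fun N => by linarith [one_sub_sum_le_sqrt hx N]) fun N => (hx.2 N).1

lemma continuousOn_volterra_tightSet (hbound : ∀ k i, |a k i| ≤ 1) {y : ℕ → ℝ}
    (hy : HasSum y 1) : ContinuousOn (volterra a) (tightSet y) := by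
  refine continuousOn_pi.2 fun k => ?_
  refine (continuous_apply k).continuousOn.mul (continuousOn_const.add ?_)
  have hunif : TendstoUniformlyOn (fun N (x : ℕ → ℝ) => ∑ i ∈ Finset.range N, a k i * x i)
      (fun x => ∑' i, a k i * x i) Filter.atTop (tightSet y) := by
    rw [Metric.tendstoUniformlyOn_iff]
    intro ε hε
    filter_upwards [(tendsto_sqrt_tail hy).eventually_lt_const hε] with N hN x hx
    have hxS := mem_simplexS_iff.1 (tightSet_subset_simplexS hy hx)
    refine lt_of_le_of_lt ?_ ((one_sub_sum_le_sqrt hx N).trans_lt hN)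
    have hs := (summable_bounded_mul (hbound k) hxS.2.summable).hasSum
    have h1 := sum_le_hasSum (Finset.range N) (fun i _ => by
      nlinarith [hxS.1 i, (abs_le.mp (hbound k i)).2]) (hxS.2.sub hs)
    have h2 := sum_le_hasSum (Finset.range N) (fun i _ => by
      nlinarith [hxS.1 i, (abs_le.mp (hbound k i)).1]) (hxS.2.add hs)
    rw [Finset.sum_sub_distrib] at h1
    rw [Finset.sum_add_distrib] at h2
    rw [Real.dist_eq, abs_le]
    constructor <;> linarith
  refine hunif.continuousOn (Filter.Eventually.of_forall fun N => ?_).frequently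
  exact Continuous.continuousOn (by fun_prop)

/-- The first `n` terms of `y`, followed by the missing mass in position `n`. -/
noncomputable def lumpTail (y : ℕ → ℝ) (n i : ℕ) : ℝ :=
  if i < n then y i else if i = n then 1 - ∑ j ∈ Finset.range n, y j else 0

lemma sum_range_lumpTail (y : ℕ → ℝ) (n N : ℕ) :
    ∑ i ∈ Finset.range N, lumpTail y n i = if N ≤ n then ∑ i ∈ Finset.range N, y i else 1 := by
  have hle : ∀ N ≤ n, ∑ i ∈ Finset.range N, lumpTail y n i = ∑ i ∈ Finset.range N, y i :=
    fun N hN => Finset.sum_congr rfl fun i hi => if_pos ((Finset.mem_range.1 hi).trans_le hN)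
  split_ifs with h
  · exact hle N h
  · rw [← Finset.sum_subset (Finset.range_mono (show n + 1 ≤ N by omega)) fun i _ hi => ?_,
      Finset.sum_range_succ, hle n le_rfl]
    · simp [lumpTail]
    · rw [Finset.mem_range] at hi
      rw [lumpTail, if_neg (by omega), if_neg (by omega)]

lemma lumpTail_mem_simplexS {y : ℕ → ℝ} (hy : y ∈ simplexS) (n : ℕ) :
    lumpTail y n ∈ simplexS := by
  rw [mem_simplexS_iff] at hy ⊢
  have h0 : ∀ i, 0 ≤ lumpTail y n i := fun i => by
    rw [lumpTail]
    split_ifs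
    exacts [hy.1 i, sub_nonneg.2 (sum_le_hasSum _ (fun j _ => hy.1 j) hy.2), le_rfl]
  refine ⟨h0, (hasSum_iff_tendsto_nat_of_nonneg h0 1).2 (tendsto_const_nhds.congr' ?_)⟩
  filter_upwards [Filter.eventually_gt_atTop n] with N hN
  rw [sum_range_lumpTail, if_neg hN.not_ge]

lemma surjOn_volterra (hskew : ∀ k i, a k i = -(a i k)) (hbound : ∀ k i, |a k i| ≤ 1) :
    Set.SurjOn (volterra a) simplexS simplexS := by
  intro y hy
  have hy' := mem_simplexS_iff.1 hy
  refine Set.image_mono (tightSet_subset_simplexS hy'.2) ?_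
  have hclosed : IsClosed (volterra a '' tightSet y) :=
    ((isCompact_tightSet y).image_of_continuousOn
      (continuousOn_volterra_tightSet hbound hy'.2)).isClosed
  have hlim : Filter.Tendsto (lumpTail y) Filter.atTop (nhds y) := by
    refine tendsto_pi_nhds.2 fun i => tendsto_const_nhds.congr' ?_
    filter_upwards [Filter.eventually_gt_atTop i] with n hn
    rw [lumpTail, if_pos hn]
  refine hclosed.mem_of_tendsto hlim (Filter.Eventually.of_forall fun n => ?_)
  obtain ⟨x, hx, hxy⟩ := exists_volterra_preimage_of_finite_support hskew hbound
    (lumpTail_mem_simplexS hy n) (n := n + 1) fun i hi => by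
      rw [lumpTail, if_neg (by omega), if_neg (by omega)]
  have hx' := mem_simplexS_iff.1 hx
  refine ⟨x, ⟨hx'.1, fun N => ⟨sum_le_hasSum _ (fun j _ => hx'.1 j) hx'.2, ?_⟩⟩, hxy⟩
  refine (sum_range_volterra_le hskew hbound hx N).trans ?_
  rw [hxy, sum_range_lumpTail]
  split_ifs
  · exact le_rfl
  · linarith [sum_le_hasSum (Finset.range N) (fun j _ => hy'.1 j) hy'.2]

end Volterra

/-- every Volterra operator is a bijection of `S` onto itself. -/
theorem stmt6 (a : ℕ → ℕ → ℝ)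
    (hskew : ∀ k i, a k i = -(a i k))
    (hbound : ∀ k i, |a k i| ≤ 1) :
    Set.BijOn (volterra a) simplexS simplexS :=
  ⟨mapsTo_volterra hskew hbound, injOn_volterra hskew hbound, surjOn_volterra hskew hbound⟩
end

section
/- Let V be a Volterra operator on S with matrix a, and let Q = {y ∈ S | Σ_i a k i · y_i ≤ 0 for every k ∈ ℕ}. Then every element of Q is a fixed point of V: Q ⊆ Fix(V). -/
/-- The quadratic form of a bounded skew-symmetric matrix vanishes on `ℓ¹`; each term being
nonpositive, all of them vanish. -/
theorem mul_tsum_eq_zero_of_skew {ι : Type*} {a : ι → ι → ℝ}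
    (hskew : ∀ k i, a k i = -(a i k)) {C : ℝ} (hbound : ∀ k i, |a k i| ≤ C)
    {y : ι → ℝ} (hy : Summable y) (h0 : ∀ i, 0 ≤ y i)
    (hQ : ∀ k, ∑' i, a k i * y i ≤ 0) (k : ι) :
    y k * ∑' i, a k i * y i = 0 := by
  have hF : Summable fun p : ι × ι => y p.1 * (a p.1 p.2 * y p.2) := by
    refine Summable.of_norm_bounded ((hy.mul_of_nonneg hy h0 h0).mul_left C) fun p => ?_
    have hp : 0 ≤ y p.1 * y p.2 := mul_nonneg (h0 _) (h0 _)
    rw [show y p.1 * (a p.1 p.2 * y p.2) = a p.1 p.2 * (y p.1 * y p.2) by ring,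
      Real.norm_eq_abs, abs_mul, abs_of_nonneg hp]
    exact mul_le_mul_of_nonneg_right (hbound _ _) hp
  have hG : Summable fun k => y k * ∑' i, a k i * y i := by
    simpa only [tsum_mul_left] using hF.prod
  have hsum : ∑' k, y k * ∑' i, a k i * y i = 0 := by
    have hanti : ∑' k, ∑' i, y k * (a k i * y i) = -∑' k, ∑' i, y k * (a k i * y i) := by
      conv_lhs => rw [← Summable.tsum_comm (f := fun k i => y k * (a k i * y i)) hF]
      simp only [← tsum_neg]
      refine tsum_congr fun k => tsum_congr fun i => ?_
      rw [hskew i k]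
      ring
    simp only [tsum_mul_left] at hanti
    linarith
  have hneg : HasSum (fun k => -(y k * ∑' i, a k i * y i)) 0 := by
    simpa [hsum] using hG.hasSum.neg
  have hzero := (hasSum_zero_iff_of_nonneg fun k =>
    neg_nonneg.2 (mul_nonpos_of_nonneg_of_nonpos (h0 k) (hQ k))).1 hneg
  simpa only [Pi.zero_apply, neg_eq_zero] using congrFun hzero k

/-- every element of the set
`Q = {y ∈ S | Σ_i a k i · y_i ≤ 0 for every k}` is a fixed point of the Volterra
operator with matrix `a`. -/
theorem stmt9 (a : ℕ → ℕ → ℝ)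
    (hskew : ∀ k i, a k i = -(a i k))
    (hbound : ∀ k i, |a k i| ≤ 1)
    (y : ℕ → ℝ) (hy : y ∈ simplexS)
    (hQ : ∀ k : ℕ, ∑' i, a k i * y i ≤ 0) :
    volterra a y = y := by
  funext k
  have hk := mul_tsum_eq_zero_of_skew hskew hbound hy.2.1 hy.1 hQ k
  rw [volterra, mul_add, mul_one, hk, add_zero]
end

section
/- Let V be a Volterra operator on S with matrix a, and let Q = {y ∈ S | Σ_i a k i · y_i ≤ 0 for every k ∈ ℕ}. Suppose x⁰ ∈ S satisfies x⁰_i > 0 for every i ∈ ℕ and V(x⁰) ≠ x⁰, and suppose the iterates V^n(x⁰) converge in ℓ¹-norm to some x̃ ∈ S as n → ∞. Then x̃ ∈ Q. -/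
open Filter Topology

theorem summable_mul_of_abs_le_one {b x : ℕ → ℝ} (hb : ∀ i, |b i| ≤ 1) (hx : Summable x) :
    Summable fun i => b i * x i := by
  refine Summable.of_norm_bounded hx.abs fun i => ?_
  rw [Real.norm_eq_abs, abs_mul]
  exact mul_le_of_le_one_left (abs_nonneg _) (hb i)

/-- The quadratic form of a bounded skew-symmetric matrix vanishes on nonnegative
summable sequences. -/
theorem hasSum_mul_tsum_skew {a : ℕ → ℕ → ℝ} (hskew : ∀ k i, a k i = -(a i k))
    (hbound : ∀ k i, |a k i| ≤ 1) {x : ℕ → ℝ} (hx : Summable x) :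
    HasSum (fun k => x k * ∑' i, a k i * x i) 0 := by
  have hprod : Summable fun p : ℕ × ℕ => x p.1 * (a p.1 p.2 * x p.2) := by
    have habs : Summable fun p : ℕ × ℕ => |x p.1| * |x p.2| :=
      hx.abs.mul_of_nonneg hx.abs (fun i => abs_nonneg _) fun i => abs_nonneg _
    refine Summable.of_norm_bounded habs fun p => ?_
    rw [Real.norm_eq_abs, abs_mul, abs_mul]
    exact mul_le_mul_of_nonneg_left
      (mul_le_of_le_one_left (abs_nonneg _) (hbound _ _)) (abs_nonneg _)
  have hrow : ∀ k, HasSum (fun i => x k * (a k i * x i)) (x k * ∑' i, a k i * x i) := fun k =>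
    (summable_mul_of_abs_le_one (hbound k) hx).hasSum.mul_left (x k)
  have hsum := hprod.hasSum.prod_fiberwise hrow
  have hneg : ∑' p : ℕ × ℕ, x p.1 * (a p.1 p.2 * x p.2)
      = -∑' p : ℕ × ℕ, x p.1 * (a p.1 p.2 * x p.2) := by
    rw [← tsum_neg]
    refine (Equiv.tsum_eq (Equiv.prodComm ℕ ℕ) _).symm.trans (tsum_congr fun p => ?_)
    simp only [Equiv.prodComm_apply, Prod.fst_swap, Prod.snd_swap]
    rw [hskew p.2 p.1]
    ring
  rwa [self_eq_neg.mp hneg] at hsum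

/-- A Volterra operator maps the set of points of the simplex with positive coordinates into
itself. -/
theorem volterra_mem_simplexS_and_pos {a : ℕ → ℕ → ℝ} (hskew : ∀ k i, a k i = -(a i k))
    (hbound : ∀ k i, |a k i| ≤ 1) {x : ℕ → ℝ} (hx : x ∈ simplexS) (hpos : ∀ i, 0 < x i) :
    volterra a x ∈ simplexS ∧ ∀ i, 0 < volterra a x i := by
  obtain ⟨hnonneg, hsummable, hone⟩ := hx
  have hpos' : ∀ k, 0 < volterra a x k := fun k => by
    have hs := summable_mul_of_abs_le_one (hbound k) hsummable
    have hlt : 0 < ∑' i, (a k i * x i + x i) := by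
      refine (hs.add hsummable).tsum_pos (fun i => ?_) k ?_
      · nlinarith [neg_le_of_abs_le (hbound k i), hnonneg i]
      · have hdiag : a k k = 0 := self_eq_neg.mp (hskew k k)
        simpa [hdiag] using hpos k
    rw [hs.tsum_add hsummable, hone] at hlt
    exact mul_pos (hpos k) (by linarith)
  have hsum : HasSum (volterra a x) 1 := by
    have h := hsummable.hasSum.add (hasSum_mul_tsum_skew hskew hbound hsummable)
    rw [hone, add_zero] at h
    refine h.congr_fun fun k => ?_
    simp only [volterra]
    ring
  exact ⟨⟨fun i => (hpos' i).le, hsum.summable, hsum.tsum_eq⟩, hpos'⟩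

theorem iterate_volterra_mem_simplexS_and_pos {a : ℕ → ℕ → ℝ} (hskew : ∀ k i, a k i = -(a i k))
    (hbound : ∀ k i, |a k i| ≤ 1) {x : ℕ → ℝ} (hx : x ∈ simplexS) (hpos : ∀ i, 0 < x i) (n : ℕ) :
    (volterra a)^[n] x ∈ simplexS ∧ ∀ i, 0 < (volterra a)^[n] x i := by
  induction n with
  | zero => exact ⟨hx, hpos⟩
  | succ n ih =>
    rw [Function.iterate_succ_apply']
    exact volterra_mem_simplexS_and_pos hskew hbound ih.1 ih.2

/-- Pairing with a sequence bounded by one is continuous for `ℓ¹` convergence. -/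
theorem tendsto_tsum_mul_of_tendsto_tsum_abs_sub {b y : ℕ → ℝ} {x : ℕ → ℕ → ℝ}
    (hb : ∀ i, |b i| ≤ 1) (hx : ∀ n, Summable (x n)) (hy : Summable y)
    (h : Tendsto (fun n => ∑' i, |x n i - y i|) atTop (𝓝 0)) :
    Tendsto (fun n => ∑' i, b i * x n i) atTop (𝓝 (∑' i, b i * y i)) := by
  rw [tendsto_iff_dist_tendsto_zero]
  refine squeeze_zero (fun n => dist_nonneg) (fun n => ?_) h
  rw [Real.dist_eq, ← (summable_mul_of_abs_le_one hb (hx n)).tsum_sub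
    (summable_mul_of_abs_le_one hb hy), ← Real.norm_eq_abs]
  refine tsum_of_norm_bounded ((hx n).sub hy).abs.hasSum fun i => ?_
  rw [← mul_sub, Real.norm_eq_abs, abs_mul]
  exact mul_le_of_le_one_left (abs_nonneg _) (hb i)

/-- if `x⁰ ∈ S` has all coordinates positive, is not fixed by the
Volterra operator `V`, and the iterates `V^n(x⁰)` converge in `ℓ¹`-norm to
`x̃ ∈ S`, then `x̃` belongs to `Q = {y ∈ S | Σ_i a k i y_i ≤ 0 for all k}`. -/
theorem stmt10 (a : ℕ → ℕ → ℝ)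
    (hskew : ∀ k i, a k i = -(a i k))
    (hbound : ∀ k i, |a k i| ≤ 1)
    (x0 : ℕ → ℝ) (hx0 : x0 ∈ simplexS) (hpos : ∀ i, 0 < x0 i)
    (hnotfix : volterra a x0 ≠ x0)
    (xt : ℕ → ℝ) (hxt : xt ∈ simplexS)
    (hconv : Filter.Tendsto (fun n => ∑' k, |(volterra a)^[n] x0 k - xt k|)
      Filter.atTop (nhds 0)) :
    ∀ k : ℕ, ∑' i, a k i * xt i ≤ 0 := by
  intro k
  by_contra! hc
  have hmem := iterate_volterra_mem_simplexS_and_pos hskew hbound hx0 hpos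
  have hsummable : ∀ n, Summable ((volterra a)^[n] x0) := fun n => (hmem n).1.2.1
  have hrow := tendsto_tsum_mul_of_tendsto_tsum_abs_sub (hbound k) hsummable hxt.2.1 hconv
  have hcoord : Tendsto (fun n => (volterra a)^[n] x0 k) atTop (𝓝 (xt k)) := by
    rw [tendsto_iff_dist_tendsto_zero]
    refine squeeze_zero (fun n => dist_nonneg) (fun n => ?_) hconv
    exact ((hsummable n).sub hxt.2.1).abs.le_tsum k fun i _ => abs_nonneg _
  have hstep : ∀ n, (volterra a)^[n + 1] x0 k
      = (volterra a)^[n] x0 k * (1 + ∑' i, a k i * (volterra a)^[n] x0 i) := fun n => by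
    rw [Function.iterate_succ_apply', volterra]
  have hzero : xt k = 0 := by
    have h := (tendsto_add_atTop_iff_nat 1).mpr hcoord
    simp only [hstep] at h
    have heq := tendsto_nhds_unique h (hcoord.mul (hrow.const_add 1))
    have hmul : xt k * ∑' i, a k i * xt i = 0 := by linarith
    exact (mul_eq_zero.mp hmul).resolve_right hc.ne'
  obtain ⟨N, hN⟩ := eventually_atTop.mp (hrow.eventually_const_lt hc)
  have hle : ∀ n ≥ N, (volterra a)^[N] x0 k ≤ (volterra a)^[n] x0 k := fun n hn => by
    induction n, hn using Nat.le_induction with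
    | base => exact le_rfl
    | succ n hn ih =>
      rw [hstep]
      exact ih.trans (le_mul_of_one_le_right ((hmem n).2 k).le (by linarith [hN n hn]))
  have hlim := ge_of_tendsto hcoord (eventually_atTop.mpr ⟨N, hle⟩)
  linarith [(hmem N).2 k]
end

section
/- Let a : ℕ → ℕ → ℝ be skew-symmetric (a k i = −(a i k)) with |a k i| ≤ 1 for all k,i, and suppose a is finitely generated (block-diagonal with finite blocks): there exists a partition of ℕ into pairwise disjoint nonempty finite sets B₁, B₂, B₃, … whose union is ℕ, such that a k i = 0 whenever k and i lie in different blocks. Then there exists y ∈ S such that Σ_i a k i · y_i ≥ 0 for every k ∈ ℕ. -/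
open Matrix in
/-- A finite skew-symmetric game has an optimal strategy, which guarantees the value `0`. -/
theorem exists_mem_stdSimplex_mulVec_nonneg {ι : Type*} [Fintype ι] [Nonempty ι]
    (A : Matrix ι ι ℝ) (hA : ∀ i j, A i j = -A j i) :
    ∃ y ∈ stdSimplex ℝ ι, ∀ i, 0 ≤ (A *ᵥ y) i := by
  classical
  have hne : (stdSimplex ℝ ι).Nonempty := ⟨_, single_mem_stdSimplex ℝ (Classical.arbitrary ι)⟩
  have hconv := convex_stdSimplex ℝ ι
  have hcomp := isCompact_stdSimplex ℝ ι
  let f (x y : ι → ℝ) : ℝ := x ⬝ᵥ A *ᵥ y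
  have hleft (y : ι → ℝ) : IsLinearMap ℝ fun x ↦ f x y :=
    ⟨fun _ _ ↦ add_dotProduct _ _ _, fun _ _ ↦ smul_dotProduct _ _ _⟩
  have hright (x : ι → ℝ) : IsLinearMap ℝ fun y ↦ f x y :=
    ⟨fun _ _ ↦ by simp only [f, mulVec_add, dotProduct_add],
      fun _ _ ↦ by simp only [f, mulVec_smul, dotProduct_smul]⟩
  have hcleft (y : ι → ℝ) : Continuous fun x ↦ f x y :=
    ((hleft y).mk' _).continuous_of_finiteDimensional
  have hcright (x : ι → ℝ) : Continuous fun y ↦ f x y :=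
    ((hright x).mk' _).continuous_of_finiteDimensional
  obtain ⟨p, hp, q, hq, hpq⟩ := Sion.exists_isSaddlePointOn (f := f) hne hconv hcomp
    (fun y _ ↦ (hcleft y).lowerSemicontinuous.lowerSemicontinuousOn _)
    (fun y _ ↦ (((hleft y).mk' _).convexOn hconv).quasiconvexOn) hconv hne hcomp
    (fun x _ ↦ (hcright x).upperSemicontinuous.upperSemicontinuousOn _)
    (fun x _ ↦ (((hright x).mk' _).concaveOn hconv).quasiconcaveOn)
  have hzero : f p p = 0 := by
    have hT : Aᵀ = -A := by ext i j; exact hA j i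
    have h : f p p = -f p p := by
      calc f p p = p ⬝ᵥ Aᵀ *ᵥ p := by
            rw [mulVec_transpose, dotProduct_comm, ← dotProduct_mulVec]
        _ = -f p p := by rw [hT, neg_mulVec, dotProduct_neg]
    linarith
  refine ⟨q, hq, fun i ↦ ?_⟩
  simpa [f, hzero] using hpq (Pi.single i 1) (single_mem_stdSimplex ℝ i) p hp

/-- if a skew-symmetric matrix `a` with entries bounded by 1 is
finitely generated (block-diagonal with respect to a partition of `ℕ` into
pairwise disjoint nonempty finite blocks), then the system
`Σ_i a k i · y_i ≥ 0 (k ∈ ℕ)` has a solution `y ∈ S`. -/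
theorem stmt12 (a : ℕ → ℕ → ℝ)
    (hskew : ∀ k i, a k i = -(a i k))
    (hbound : ∀ k i, |a k i| ≤ 1)
    (B : ℕ → Finset ℕ)
    (hne : ∀ n, (B n).Nonempty)
    (hdisj : ∀ m n, m ≠ n → Disjoint (B m) (B n))
    (hcover : ∀ i : ℕ, ∃ n, i ∈ B n)
    (hblock : ∀ k i m n, k ∈ B m → i ∈ B n → m ≠ n → a k i = 0) :
    ∃ y ∈ simplexS, ∀ k : ℕ, 0 ≤ ∑' i, a k i * y i := by
  classical
  have : Nonempty (B 0) := (hne 0).to_subtype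
  obtain ⟨y, ⟨hy0, hy1⟩, hy⟩ := exists_mem_stdSimplex_mulVec_nonneg
    (Matrix.of fun i j : B 0 ↦ a i j) fun i j ↦ hskew i j
  let z (i : ℕ) : ℝ := if h : i ∈ B 0 then y ⟨i, h⟩ else 0
  have hz (i : ℕ) (hi : i ∉ B 0) : z i = 0 := dif_neg hi
  have hzy (i : B 0) : z i = y i := dif_pos i.2
  have hsum (g : ℕ → ℝ) : ∑' i, g i * z i = ∑ i : B 0, g i * y i := by
    rw [tsum_eq_sum (s := B 0) fun i hi ↦ by rw [hz i hi, mul_zero], ← Finset.sum_coe_sort]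
    simp only [hzy]
  refine ⟨z, ⟨fun i ↦ ?_, summable_of_ne_finset_zero hz, ?_⟩, fun k ↦ ?_⟩
  · by_cases hi : i ∈ B 0
    · exact (hy0 ⟨i, hi⟩).trans_eq (hzy ⟨i, hi⟩).symm
    · exact (hz i hi).ge
  · simpa only [one_mul] using (hsum fun _ ↦ 1).trans (by simpa only [one_mul] using hy1)
  · rw [hsum]
    by_cases hk : k ∈ B 0
    · exact hy ⟨k, hk⟩
    · obtain ⟨n, hn⟩ := hcover k
      have hn0 : n ≠ 0 := by rintro rfl; exact hk hn
      exact (Finset.sum_eq_zero fun i _ ↦ by rw [hblock k i n 0 hn i.2 hn0, zero_mul]).ge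
end

section
/- Let a : ℕ → ℕ → ℝ be skew-symmetric (a k i = −(a i k)) with |a k i| ≤ 1 for all k,i, and suppose a is finitely generated (block-diagonal with finite blocks): there exists a partition of ℕ into pairwise disjoint nonempty finite sets B₁, B₂, B₃, … whose union is ℕ, such that a k i = 0 whenever k and i lie in different blocks. Then the set Q = {y ∈ S | Σ_i a k i · y_i ≤ 0 for every k ∈ ℕ} is nonempty. -/
/-- The quadratic form of a skew-symmetric matrix vanishes. -/
theorem sum_mul_sum_skew_eq_zero {ι : Type*} [Fintype ι] (A : ι → ι → ℝ)
    (hA : ∀ k i, A k i = -(A i k)) (q : ι → ℝ) :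
    ∑ k, (∑ i, A k i * q i) * q k = 0 := by
  have h : ∑ k, (∑ i, A k i * q i) * q k = -∑ k, (∑ i, A k i * q i) * q k := by
    simp only [Finset.sum_mul]
    conv_lhs => rw [Finset.sum_comm]
    simp only [← Finset.sum_neg_distrib]
    refine Finset.sum_congr rfl fun k _ => Finset.sum_congr rfl fun i _ => ?_
    rw [hA i k]
    ring
  linarith

/-- A finite symmetric zero-sum game has an optimal mixed strategy of value at most `0`. -/
theorem exists_mem_stdSimplex_skew_le_zero {ι : Type*} [Fintype ι] [Nonempty ι]
    (A : ι → ι → ℝ) (hA : ∀ k i, A k i = -(A i k)) :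
    ∃ y ∈ stdSimplex ℝ ι, ∀ k, ∑ i, A k i * y i ≤ 0 := by
  classical
  by_contra! hcon
  let L : (ι → ℝ) →ₗ[ℝ] (ι → ℝ) := Matrix.mulVecLin (Matrix.of A)
  have hL : ∀ y k, L y k = ∑ i, A k i * y i := fun y k => rfl
  have hdisj : Disjoint (L '' stdSimplex ℝ ι) (Set.Iic 0) := by
    rw [Set.disjoint_left]
    rintro _ ⟨y, hy, rfl⟩ hle
    obtain ⟨k, hk⟩ := hcon y hy
    exact absurd (hle k) (not_le.mpr hk)
  obtain ⟨f, u, v, hu, huv, hv⟩ := geometric_hahn_banach_compact_closed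
    ((convex_stdSimplex ℝ ι).linear_image L)
    ((isCompact_stdSimplex ℝ ι).image L.continuous_of_finiteDimensional)
    (convex_Iic (0 : ι → ℝ)) isClosed_Iic hdisj
  have hv0 : v < 0 := by simpa using hv 0 (Set.mem_Iic.mpr le_rfl)
  let q : ι → ℝ := fun i => -f (Pi.single i 1)
  have hf : ∀ x, f x = -∑ i, x i * q i := by
    intro x
    conv_lhs => rw [pi_eq_sum_univ' x]
    simp [q]
  have hq : ∀ i, 0 ≤ q i := by
    intro i
    by_contra! hneg
    have hle : (Pi.single i (v / (-q i)) : ι → ℝ) ≤ 0 := by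
      rw [Pi.single_nonpos]
      exact div_nonpos_of_nonpos_of_nonneg hv0.le (by linarith)
    have h := hv _ hle
    rw [hf, Finset.sum_eq_single i (by intro j _ hj; simp [hj]) (by simp),
      Pi.single_eq_same, div_mul_eq_mul_div, div_neg, mul_div_cancel_right₀ _ hneg.ne] at h
    linarith
  have hneg : ∀ y ∈ stdSimplex ℝ ι, f (L y) < 0 := fun y hy =>
    (hu _ ⟨y, hy, rfl⟩).trans (huv.trans hv0)
  have hs : 0 < ∑ i, q i := by
    refine (Finset.sum_nonneg fun i _ => hq i).lt_of_ne fun h => ?_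
    have hz : ∀ i, q i = 0 := fun i =>
      (Finset.sum_eq_zero_iff_of_nonneg fun i _ => hq i).mp h.symm i (Finset.mem_univ i)
    have h := hneg _ (single_mem_stdSimplex ℝ (Classical.arbitrary ι))
    simp [hf, hz] at h
  have hy : (∑ i, q i)⁻¹ • q ∈ stdSimplex ℝ ι := by
    refine ⟨fun i => mul_nonneg (inv_nonneg.mpr hs.le) (hq i), ?_⟩
    simp only [Pi.smul_apply, smul_eq_mul, ← Finset.mul_sum]
    exact inv_mul_cancel₀ hs.ne'
  have h := hneg _ hy
  rw [map_smul, map_smul, hf] at h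
  simp only [hL, sum_mul_sum_skew_eq_zero A hA q] at h
  simp at h

/-- if a skew-symmetric matrix `a` with entries bounded by 1 is
finitely generated (block-diagonal with respect to a partition of `ℕ` into
pairwise disjoint nonempty finite blocks), then the set
`Q = {y ∈ S | Σ_i a k i · y_i ≤ 0 for every k}` is nonempty. -/
theorem stmt13 (a : ℕ → ℕ → ℝ)
    (hskew : ∀ k i, a k i = -(a i k))
    (hbound : ∀ k i, |a k i| ≤ 1)
    (B : ℕ → Finset ℕ)
    (hne : ∀ n, (B n).Nonempty)
    (hdisj : ∀ m n, m ≠ n → Disjoint (B m) (B n))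
    (hcover : ∀ i : ℕ, ∃ n, i ∈ B n)
    (hblock : ∀ k i m n, k ∈ B m → i ∈ B n → m ≠ n → a k i = 0) :
    ∃ y ∈ simplexS, ∀ k : ℕ, ∑' i, a k i * y i ≤ 0 := by
  classical
  have : Nonempty (B 0) := (hne 0).to_subtype
  obtain ⟨y, ⟨hy0, hy1⟩, hy⟩ := exists_mem_stdSimplex_skew_le_zero
    (fun k i : B 0 => a k i) (fun k i => hskew k i)
  let z : ℕ → ℝ := fun i => if h : i ∈ B 0 then y ⟨i, h⟩ else 0
  have hz : ∀ i : B 0, z i = y i := fun i => by simp [z]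
  have hz0 : ∀ i, i ∉ B 0 → z i = 0 := fun i hi => by simp [z, hi]
  refine ⟨z, ⟨fun i => ?_, summable_of_ne_finset_zero (s := B 0) hz0, ?_⟩, fun k => ?_⟩
  · by_cases h : i ∈ B 0
    · simpa [z, h] using hy0 ⟨i, h⟩
    · exact (hz0 i h).ge
  · rw [tsum_eq_sum (s := B 0) hz0, ← Finset.sum_coe_sort]
    simpa only [hz] using hy1
  · rw [tsum_eq_sum (s := B 0) fun i hi => by rw [hz0 i hi, mul_zero]]
    by_cases hk : k ∈ B 0
    · rw [← Finset.sum_coe_sort]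
      simpa only [hz] using hy ⟨k, hk⟩
    · obtain ⟨n, hn⟩ := hcover k
      have hn0 : n ≠ 0 := by rintro rfl; exact hk hn
      refine (Finset.sum_eq_zero fun i hi => ?_).le
      rw [hblock k i n 0 hn hi hn0, zero_mul]
end

section
/- Index sequences by ℕ starting at 1 and define the skew-symmetric matrix a by a k i = (−1)^i if i > k, a k i = (−1)^{k+1} if i < k, and a k k = 0. Then the set Q = {y ∈ S | Σ_i a k i · y_i ≤ 0 for every k} is empty: there is no y ∈ S satisfying Σ_i a k i · y_i ≤ 0 for all k. -/
/-- The skew-symmetric matrix of Example 5.2: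
`a k i = (−1)^i` for `i > k`, `a k i = (−1)^(k+1)` for `i < k`, `a k k = 0`. -/
noncomputable def exampleMatrix : ℕ → ℕ → ℝ := fun k i =>
  if k < i then (-1 : ℝ) ^ i else if i < k then (-1 : ℝ) ^ (k + 1) else 0

open Filter Topology in
/-- Along the odd rows, `Σ_i a k i · y_i` converges to `Σ_i y_i`. -/
theorem tendsto_tsum_exampleMatrix_odd {y : ℕ → ℝ} (hy : Summable y) (h0 : ∀ i, 0 ≤ y i) :
    Tendsto (fun n : ℕ => ∑' i, exampleMatrix (2 * n + 1) i * y i) atTop (𝓝 (∑' i, y i)) := by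
  refine tendsto_tsum_of_dominated_convergence hy (fun i => ?_) (Eventually.of_forall fun n i => ?_)
  · refine tendsto_const_nhds.congr' ?_
    filter_upwards [eventually_ge_atTop i] with n hn
    have h₁ : ¬ 2 * n + 1 < i := by omega
    have h₂ : i < 2 * n + 1 := by omega
    have h₃ : Even (2 * n + 1 + 1) := ⟨n + 1, by ring⟩
    simp [exampleMatrix, h₁, h₂, h₃.neg_one_pow]
  · rw [norm_mul, Real.norm_of_nonneg (h0 i)]
    refine mul_le_of_le_one_left (h0 i) ?_
    unfold exampleMatrix
    split_ifs <;> simp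

/-- for the matrix of Example 5.2 the set
`Q = {y ∈ S | Σ_i a k i · y_i ≤ 0 for every k}` is empty. -/
theorem stmt14 :
    ¬ ∃ y ∈ simplexS, ∀ k : ℕ, ∑' i, exampleMatrix k i * y i ≤ 0 := by
  rintro ⟨y, ⟨h0, hs, h1⟩, hQ⟩
  have h := le_of_tendsto' (tendsto_tsum_exampleMatrix_odd hs h0) fun n => hQ (2 * n + 1)
  linarith
end

section
/- Index sequences by ℕ starting at 1. Let a : ℕ → ℕ → ℝ be skew-symmetric with |a k i| ≤ 1 for all k,i, let V be the Volterra operator with matrix a, and for each n ∈ ℕ let V_n be the Volterra operator whose matrix is the truncation a^(n) of a, where a^(n) k i = a k i if k ≤ n and i ≤ n, and a^(n) k i = 0 otherwise. Then for every m ∈ ℕ, every x ∈ S, and every k ∈ ℕ, the sequence ((V_n^m x)_k)_{n∈ℕ} converges as n → ∞, and its limit is (V^m x)_k. -/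
/-- The truncation `a^(n)` of a matrix `a`: `a^(n) k i = a k i` if `k ≤ n` and
`i ≤ n`, and `a^(n) k i = 0` otherwise. -/
def truncMatrix (a : ℕ → ℕ → ℝ) (n : ℕ) : ℕ → ℕ → ℝ :=
  fun k i => if k ≤ n ∧ i ≤ n then a k i else 0

theorem abs_volterra_le {b : ℕ → ℕ → ℝ} (hb : ∀ k i, |b k i| ≤ 1) {x y : ℕ → ℝ}
    (hx : x ∈ simplexS) {C : ℝ} (hy : ∀ i, |y i| ≤ C * x i) (k : ℕ) :
    |volterra b y k| ≤ C * (1 + C) * x k := by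
  obtain ⟨-, hsum, htsum⟩ := hx
  have hterm : ∀ i, ‖b k i * y i‖ ≤ C * x i := fun i => by
    rw [Real.norm_eq_abs, abs_mul]
    exact (mul_le_of_le_one_left (abs_nonneg _) (hb k i)).trans (hy i)
  have hC : |∑' i, b k i * y i| ≤ C := by
    have h := tsum_of_norm_bounded (hsum.mul_left C).hasSum hterm
    rwa [tsum_mul_left, htsum, mul_one, Real.norm_eq_abs] at h
  calc |volterra b y k| = |y k| * |1 + ∑' i, b k i * y i| := abs_mul _ _
    _ ≤ C * x k * (1 + C) := by
      refine mul_le_mul (hy k) ?_ (abs_nonneg _) ((abs_nonneg _).trans (hy k))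
      exact (abs_add_le _ _).trans (by simpa using hC)
    _ = C * (1 + C) * x k := by ring

/-- The iterates of all Volterra operators with entries bounded by `1` are dominated by a common
multiple of the starting point. -/
theorem exists_abs_volterra_iterate_le {x : ℕ → ℝ} (hx : x ∈ simplexS) (m : ℕ) :
    ∃ C : ℝ, ∀ b : ℕ → ℕ → ℝ, (∀ k i, |b k i| ≤ 1) → ∀ k, |(volterra b)^[m] x k| ≤ C * x k := by
  induction m with
  | zero => exact ⟨1, fun b _ k => by simp [abs_of_nonneg (hx.1 k)]⟩
  | succ m ih =>
    obtain ⟨C, hC⟩ := ih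
    refine ⟨C * (1 + C), fun b hb k => ?_⟩
    rw [Function.iterate_succ_apply']
    exact abs_volterra_le hb hx (hC b hb) k

theorem abs_truncMatrix_le {a : ℕ → ℕ → ℝ} (ha : ∀ k i, |a k i| ≤ 1) (n k i : ℕ) :
    |truncMatrix a n k i| ≤ 1 := by
  unfold truncMatrix
  split_ifs
  · exact ha k i
  · simp

theorem tendsto_truncMatrix (a : ℕ → ℕ → ℝ) (k i : ℕ) :
    Filter.Tendsto (fun n => truncMatrix a n k i) Filter.atTop (nhds (a k i)) := by
  refine tendsto_const_nhds.congr' ?_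
  filter_upwards [Filter.eventually_ge_atTop k, Filter.eventually_ge_atTop i] with n hk hi
  simp [truncMatrix, hk, hi]

/-- Theorems 6.4 and 6.7: for every `m`, every `x ∈ S` and every
coordinate `k`, the iterates of the truncated Volterra operators converge, and
their limit is the corresponding iterate of the full Volterra operator. -/
theorem stmt19 (a : ℕ → ℕ → ℝ)
    (hskew : ∀ k i, a k i = -(a i k))
    (hbound : ∀ k i, |a k i| ≤ 1)
    (x : ℕ → ℝ) (hx : x ∈ simplexS) (m k : ℕ) :
    Filter.Tendsto (fun n => (volterra (truncMatrix a n))^[m] x k)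
      Filter.atTop (nhds ((volterra a)^[m] x k)) := by
  induction m generalizing k with
  | zero => exact tendsto_const_nhds
  | succ m ih =>
    obtain ⟨C, hC⟩ := exists_abs_volterra_iterate_le hx m
    simp only [Function.iterate_succ_apply']
    refine (ih k).mul (tendsto_const_nhds.add ?_)
    refine tendsto_tsum_of_dominated_convergence (hx.2.1.mul_left C)
      (fun i => (tendsto_truncMatrix a k i).mul (ih i)) (Filter.Eventually.of_forall fun n i => ?_)
    rw [Real.norm_eq_abs, abs_mul]
    exact (mul_le_of_le_one_left (abs_nonneg _) (abs_truncMatrix_le hbound n k i)).trans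
      (hC _ (abs_truncMatrix_le hbound n) i)
end
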